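/- Let S be an inverse semigroup and let N be a full inverse subsemigroup of S with the kernel property. Then ≃_N is a congruence on S if and only if the relation J_N restricted to E(S) is a normal congruence on the semilattice E(S); and in that case ≃_N is the minimal congruence on S with kernel N, i.e. for every congruence ρ on S whose kernel is N, s ≃_N t implies s ρ t. -/

import Mathlib

/-- An inverse semigroup: a semigroup in which every element `s` has a
(unique) inverse `s⁻¹` with `s * s⁻¹ * s = s` and `s⁻¹ * s * s⁻¹ = s⁻¹`. -/
class InverseSemigroup (S : Type*) extends Semigroup S, Inv S where
  mul_inv_mul : ∀ s : S, s * s⁻¹ * s = s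
  inv_mul_inv : ∀ s : S, s⁻¹ * s * s⁻¹ = s⁻¹
  inv_unique : ∀ s t : S, s * t * s = s → t * s * t = t → t = s⁻¹

/-- The natural partial order on an inverse semigroup:
`s ≤ t` iff `s = e * t` for some idempotent `e`. -/
def NatLe {S : Type*} [InverseSemigroup S] (s t : S) : Prop :=
  ∃ e : S, IsIdempotentElem e ∧ s = e * t

/-- A normal inverse subsemigroup: a full inverse subsemigroup that is
closed under conjugation. -/
structure IsNormalInverseSubsemigroup {S : Type*} [InverseSemigroup S] (N : Set S) : Prop where
  mul_mem : ∀ {a b : S}, a ∈ N → b ∈ N → a * b ∈ N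
  inv_mem : ∀ {a : S}, a ∈ N → a⁻¹ ∈ N
  full : ∀ {e : S}, IsIdempotentElem e → e ∈ N
  conj_mem : ∀ (s : S) {n : S}, n ∈ N → s⁻¹ * n * s ∈ N

/-- The preorder `≤_N` associated to a normal inverse subsemigroup `N`:
`s ≤_N t` iff there are `a, b ∈ N` with `a⁻¹ * a = s * s⁻¹`,
`s⁻¹ * s = b * b⁻¹` (so `a · s · b` is a trace product) and `a * s * b ≤ t`. -/
def LeN {S : Type*} [InverseSemigroup S] (N : Set S) (s t : S) : Prop :=
  ∃ a ∈ N, ∃ b ∈ N, a⁻¹ * a = s * s⁻¹ ∧ s⁻¹ * s = b * b⁻¹ ∧ NatLe (a * s * b) t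

/-- The equivalence `≃_N` obtained by symmetrizing `≤_N`. -/
def SimeqN {S : Type*} [InverseSemigroup S] (N : Set S) (s t : S) : Prop :=
  LeN N s t ∧ LeN N t s

/-- A congruence on a semigroup: an equivalence relation compatible with
multiplication. -/
structure IsCongruence {S : Type*} [InverseSemigroup S] (ρ : S → S → Prop) : Prop where
  refl : ∀ s : S, ρ s s
  symm : ∀ {s t : S}, ρ s t → ρ t s
  trans : ∀ {s t u : S}, ρ s t → ρ t u → ρ s u
  mul_compat : ∀ {a b c d : S}, ρ a b → ρ c d → ρ (a * c) (b * d)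

/-- Green's relation `J_N` induced by `N` on the idempotents of `S`:
`e J_N f` iff there are `m, n ∈ N` with `m⁻¹ m = e`, `m m⁻¹ ≤ f`,
`n⁻¹ n = f` and `n n⁻¹ ≤ e`. -/
def JN {S : Type*} [InverseSemigroup S] (N : Set S) (e f : S) : Prop :=
  ∃ m ∈ N, ∃ n ∈ N,
    m⁻¹ * m = e ∧ NatLe (m * m⁻¹) f ∧ n⁻¹ * n = f ∧ NatLe (n * n⁻¹) e

/-- A relation `ν` is a normal congruence on the semilattice `E(S)`:
an equivalence relation on the idempotents, compatible with multiplication of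
idempotents, and stable under conjugation. -/
def IsNormalCongruenceOnE {S : Type*} [InverseSemigroup S] (ν : S → S → Prop) : Prop :=
  (∀ e : S, IsIdempotentElem e → ν e e) ∧
  (∀ e f : S, ν e f → ν f e) ∧
  (∀ e f g : S, ν e f → ν f g → ν e g) ∧
  (∀ e f e' f' : S, IsIdempotentElem e → IsIdempotentElem f →
    IsIdempotentElem e' → IsIdempotentElem f' →
    ν e e' → ν f f' → ν (e * f) (e' * f')) ∧
  (∀ (s : S) (e f : S), ν e f → ν (s⁻¹ * e * s) (s⁻¹ * f * s))

namespace InverseSemigroup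

variable {S : Type*} [InverseSemigroup S]

theorem eq_inv_of {s t : S} (h₁ : s * t * s = s) (h₂ : t * s * t = t) : t = s⁻¹ :=
  inv_unique s t h₁ h₂

theorem inv_inv' (s : S) : s⁻¹⁻¹ = s :=
  (eq_inv_of (inv_mul_inv s) (mul_inv_mul s)).symm

theorem mul_inv_cancel_left' (s x : S) : s * (s⁻¹ * (s * x)) = s * x := by
  rw [← mul_assoc, ← mul_assoc, mul_inv_mul]

theorem inv_mul_cancel_left' (s x : S) : s⁻¹ * (s * (s⁻¹ * x)) = s⁻¹ * x := by
  rw [← mul_assoc, ← mul_assoc, inv_mul_inv]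

theorem mul_inv_mul' (s : S) : s * (s⁻¹ * s) = s := by
  rw [← mul_assoc, mul_inv_mul]

theorem inv_mul_inv' (s : S) : s⁻¹ * (s * s⁻¹) = s⁻¹ := by
  rw [← mul_assoc, inv_mul_inv]

theorem inv_of_idem {e : S} (he : IsIdempotentElem e) : e⁻¹ = e :=
  (eq_inv_of (by rw [he.eq, he.eq]) (by rw [he.eq, he.eq])).symm

theorem idem_mul_left {e : S} (he : IsIdempotentElem e) (x : S) : e * (e * x) = e * x := by
  rw [← mul_assoc, he.eq]

theorem isIdempotentElem_mul {e f : S} (he : IsIdempotentElem e) (hf : IsIdempotentElem f) :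
    IsIdempotentElem (e * f) := by
  obtain ⟨x, hx⟩ : ∃ x, x = (e * f)⁻¹ := ⟨_, rfl⟩
  have h₁ : e * (f * (x * (e * f))) = e * f := by
    have := mul_inv_mul (e * f)
    rwa [← hx, mul_assoc, mul_assoc] at this
  have h₂ : x * (e * (f * x)) = x := by
    have := inv_mul_inv (e * f)
    rw [← hx] at this
    simpa only [mul_assoc] using this
  have h₃ : f * (x * e) = x := by
    rw [hx]
    apply eq_inv_of
    · simp only [mul_assoc, idem_mul_left he, idem_mul_left hf]
      rw [← hx, h₁]
    · simp only [mul_assoc, idem_mul_left he, idem_mul_left hf, ← hx]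
      conv_rhs => rw [← h₂]
      simp only [mul_assoc]
  have hxx : IsIdempotentElem x := by
    have : f * (x * e) * (f * (x * e)) = f * (x * e) := by
      conv_rhs => rw [← h₂]
      simp only [mul_assoc]
    rwa [h₃] at this
  have : e * f = x := by rw [← inv_inv' (e * f), ← hx, inv_of_idem hxx]
  rwa [this]

theorem idem_comm {e f : S} (he : IsIdempotentElem e) (hf : IsIdempotentElem f) :
    e * f = f * e := by
  have h₁ := isIdempotentElem_mul he hf
  have h₂ := isIdempotentElem_mul hf he
  have h : f * e = (e * f)⁻¹ := by
    apply eq_inv_of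
    · have := h₁.eq
      simp only [mul_assoc] at this
      simp only [mul_assoc, idem_mul_left he, idem_mul_left hf, this]
    · have := h₂.eq
      simp only [mul_assoc] at this
      simp only [mul_assoc, idem_mul_left he, idem_mul_left hf, this]
  rw [h, inv_of_idem h₁]

theorem idem_inv_mul (s : S) : IsIdempotentElem (s⁻¹ * s) := by
  simp only [IsIdempotentElem, mul_assoc, mul_inv_mul']

theorem idem_mul_inv (s : S) : IsIdempotentElem (s * s⁻¹) := by
  simp only [IsIdempotentElem, mul_assoc, inv_mul_inv']

theorem mul_inv_rev' (s t : S) : (s * t)⁻¹ = t⁻¹ * s⁻¹ := by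
  have h := idem_comm (idem_inv_mul s) (idem_mul_inv t)
  symm
  apply eq_inv_of
  · calc s * t * (t⁻¹ * s⁻¹) * (s * t) = s * ((t * t⁻¹) * (s⁻¹ * s)) * t := by
          simp only [mul_assoc]
      _ = s * t := by
          rw [← h]
          simp only [mul_assoc, mul_inv_cancel_left', mul_inv_mul']
  · calc t⁻¹ * s⁻¹ * (s * t) * (t⁻¹ * s⁻¹) = t⁻¹ * ((s⁻¹ * s) * (t * t⁻¹)) * s⁻¹ := by
          simp only [mul_assoc]
      _ = t⁻¹ * s⁻¹ := by
          rw [h]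
          simp only [mul_assoc, inv_mul_cancel_left', inv_mul_inv']

theorem idem_conj (s : S) {e : S} (he : IsIdempotentElem e) :
    IsIdempotentElem (s⁻¹ * e * s) := by
  have h := idem_comm (idem_mul_inv s) he
  calc s⁻¹ * e * s * (s⁻¹ * e * s) = s⁻¹ * e * ((s * s⁻¹) * e) * s := by simp only [mul_assoc]
    _ = s⁻¹ * e * s := by
      rw [h]
      simp only [mul_assoc, mul_inv_mul', idem_mul_left he]

theorem natLe_iff_of_idem {x f : S} (hx : IsIdempotentElem x) (hf : IsIdempotentElem f) :
    NatLe x f ↔ x * f = x := by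
  constructor
  · rintro ⟨e, -, rfl⟩
    rw [mul_assoc, hf.eq]
  · exact fun h => ⟨x, hx, h.symm⟩

section Kernel

variable {N : Set S}

theorem leN_iff
    (hmul : ∀ {a b : S}, a ∈ N → b ∈ N → a * b ∈ N)
    (hinv : ∀ {a : S}, a ∈ N → a⁻¹ ∈ N)
    (hfull : ∀ {e : S}, IsIdempotentElem e → e ∈ N)
    (hker : ∀ s t n : S, s * t ∈ N → n ∈ N → s * n * t ∈ N) (s t : S) :
    LeN N s t ↔ s * t⁻¹ ∈ N ∧ ∃ m ∈ N, m⁻¹ * m = s⁻¹ * s ∧ NatLe (m * m⁻¹) (t⁻¹ * t) := by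
  constructor
  · rintro ⟨a, ha, b, hb, hab, hsb, g, hg, hgt⟩
    refine ⟨?_, b⁻¹, hinv hb, by rw [inv_inv', hsb], ?_⟩
    · have h₁ : a * s * b * t⁻¹ ∈ N := by
        rw [hgt, mul_assoc]
        exact hfull (isIdempotentElem_mul hg (idem_mul_inv t))
      have h₂ : s * b * t⁻¹ ∈ N := by
        have := hmul (hinv ha) h₁
        have e : a⁻¹ * (a * s * b * t⁻¹) = (a⁻¹ * a) * s * b * t⁻¹ := by simp only [mul_assoc]
        rwa [e, hab, mul_inv_mul] at this
      have h₃ := hker _ _ _ h₂ (hinv hb)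
      rwa [mul_assoc s, ← hsb, mul_inv_mul'] at h₃
    · have h : b⁻¹ * b = t⁻¹ * g * t := by
        have h₁ : (a * s * b)⁻¹ * (a * s * b) = b⁻¹ * s⁻¹ * (a⁻¹ * a) * s * b := by
          simp only [mul_inv_rev', mul_assoc]
        have h₂ : b⁻¹ * s⁻¹ * (s * s⁻¹) * s * b = b⁻¹ * (s⁻¹ * s) * b := by
          simp only [mul_assoc, inv_mul_cancel_left']
        rw [hab, h₂, hsb, ← mul_assoc b⁻¹, inv_mul_inv] at h₁
        rw [← h₁, hgt, mul_inv_rev', inv_of_idem hg]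
        simp only [mul_assoc, idem_mul_left hg]
      rw [inv_inv', h, natLe_iff_of_idem (idem_conj t hg) (idem_inv_mul t)]
      simp only [mul_assoc, mul_inv_mul']
  · rintro ⟨hst, m, hm, hms, hmt⟩
    rw [natLe_iff_of_idem (idem_mul_inv m) (idem_inv_mul t)] at hmt
    have hmt' : m⁻¹ * (t⁻¹ * t) = m⁻¹ := by
      calc m⁻¹ * (t⁻¹ * t) = m⁻¹ * (m * m⁻¹ * (t⁻¹ * t)) := by
            simp only [mul_assoc, inv_mul_cancel_left']
        _ = m⁻¹ := by rw [hmt, inv_mul_inv']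
    refine ⟨t * m * s⁻¹, ?_, m⁻¹, hinv hm, ?_, ?_, ?_⟩
    · have := hinv (hker _ _ _ hst (hinv hm))
      simpa only [mul_inv_rev', inv_inv', mul_assoc] using this
    · calc (t * m * s⁻¹)⁻¹ * (t * m * s⁻¹) = s * (m⁻¹ * (t⁻¹ * t)) * m * s⁻¹ := by
            simp only [mul_inv_rev', inv_inv', mul_assoc]
        _ = s * (m⁻¹ * m) * s⁻¹ := by rw [hmt']; simp only [mul_assoc]
        _ = s * s⁻¹ := by rw [hms, mul_inv_mul']
    · rw [inv_inv', hms]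
    · have h₁ : t * m * s⁻¹ * s * m⁻¹ = t * (m * m⁻¹) := by
        calc t * m * s⁻¹ * s * m⁻¹ = t * m * (s⁻¹ * s) * m⁻¹ := by simp only [mul_assoc]
          _ = t * (m * m⁻¹) := by
            rw [← hms]
            simp only [mul_assoc, inv_mul_inv']
      refine ⟨t * (m * m⁻¹) * t⁻¹, ?_, ?_⟩
      · simpa only [inv_inv'] using idem_conj t⁻¹ (idem_mul_inv m)
      · rw [h₁]
        calc t * (m * m⁻¹) = t * (m * m⁻¹ * (t⁻¹ * t)) := by rw [hmt]
          _ = t * (m * m⁻¹) * t⁻¹ * t := by simp only [mul_assoc]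

theorem simeqN_iff
    (hmul : ∀ {a b : S}, a ∈ N → b ∈ N → a * b ∈ N)
    (hinv : ∀ {a : S}, a ∈ N → a⁻¹ ∈ N)
    (hfull : ∀ {e : S}, IsIdempotentElem e → e ∈ N)
    (hker : ∀ s t n : S, s * t ∈ N → n ∈ N → s * n * t ∈ N) (s t : S) :
    SimeqN N s t ↔ s * t⁻¹ ∈ N ∧ JN N (s⁻¹ * s) (t⁻¹ * t) := by
  rw [SimeqN, leN_iff hmul hinv hfull hker, leN_iff hmul hinv hfull hker]
  constructor
  · rintro ⟨⟨h, m, hm, h₁, h₂⟩, -, n, hn, h₃, h₄⟩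
    exact ⟨h, m, hm, n, hn, h₁, h₂, h₃, h₄⟩
  · rintro ⟨h, m, hm, n, hn, h₁, h₂, h₃, h₄⟩
    refine ⟨⟨h, m, hm, h₁, h₂⟩, ?_, n, hn, h₃, h₄⟩
    simpa only [mul_inv_rev', inv_inv'] using hinv h

theorem JN_iff_simeqN
    (hmul : ∀ {a b : S}, a ∈ N → b ∈ N → a * b ∈ N)
    (hinv : ∀ {a : S}, a ∈ N → a⁻¹ ∈ N)
    (hfull : ∀ {e : S}, IsIdempotentElem e → e ∈ N)
    (hker : ∀ s t n : S, s * t ∈ N → n ∈ N → s * n * t ∈ N) (e f : S) :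
    JN N e f ↔ IsIdempotentElem e ∧ IsIdempotentElem f ∧ SimeqN N e f := by
  have aux : IsIdempotentElem e → IsIdempotentElem f → (SimeqN N e f ↔ JN N e f) := by
    intro he hf
    rw [simeqN_iff hmul hinv hfull hker, inv_of_idem he, inv_of_idem hf, he.eq, hf.eq]
    exact and_iff_right (hfull (isIdempotentElem_mul he hf))
  constructor
  · intro h
    obtain ⟨m, -, n, -, rfl, -, rfl, -⟩ := id h
    exact ⟨idem_inv_mul m, idem_inv_mul n, (aux (idem_inv_mul m) (idem_inv_mul n)).2 h⟩
  · rintro ⟨he, hf, h⟩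
    exact (aux he hf).1 h

theorem JN_of_mem (hinv : ∀ {a : S}, a ∈ N → a⁻¹ ∈ N) {n : S} (hn : n ∈ N) :
    JN N (n⁻¹ * n) (n * n⁻¹) := by
  refine ⟨n, hn, n⁻¹, hinv hn, rfl, ?_, by rw [inv_inv'], ?_⟩
  · exact ⟨_, idem_mul_inv n, (idem_mul_inv n).eq.symm⟩
  · rw [inv_inv']
    exact ⟨_, idem_inv_mul n, (idem_inv_mul n).eq.symm⟩

theorem isNormalCongruenceOnE_JN
    (hmul : ∀ {a b : S}, a ∈ N → b ∈ N → a * b ∈ N)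
    (hinv : ∀ {a : S}, a ∈ N → a⁻¹ ∈ N)
    (hfull : ∀ {e : S}, IsIdempotentElem e → e ∈ N)
    (hker : ∀ s t n : S, s * t ∈ N → n ∈ N → s * n * t ∈ N)
    (h : IsCongruence (SimeqN N)) : IsNormalCongruenceOnE (JN N) := by
  simp only [IsNormalCongruenceOnE, JN_iff_simeqN hmul hinv hfull hker]
  refine ⟨fun e he => ⟨he, he, h.refl e⟩, ?_, ?_, ?_, ?_⟩
  · rintro e f ⟨he, hf, hef⟩
    exact ⟨hf, he, h.symm hef⟩
  · rintro e f g ⟨he, -, hef⟩ ⟨-, hg, hfg⟩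
    exact ⟨he, hg, h.trans hef hfg⟩
  · rintro e f e' f' he hf he' hf' ⟨-, -, h₁⟩ ⟨-, -, h₂⟩
    exact ⟨isIdempotentElem_mul he hf, isIdempotentElem_mul he' hf', h.mul_compat h₁ h₂⟩
  · rintro s e f ⟨he, hf, hef⟩
    exact ⟨idem_conj s he, idem_conj s hf,
      h.mul_compat (h.mul_compat (h.refl _) hef) (h.refl _)⟩

theorem JN_conj_of_simeqN
    (hmul : ∀ {a b : S}, a ∈ N → b ∈ N → a * b ∈ N)
    (hinv : ∀ {a : S}, a ∈ N → a⁻¹ ∈ N)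
    (hfull : ∀ {e : S}, IsIdempotentElem e → e ∈ N)
    (hJ : IsNormalCongruenceOnE (JN N)) {u v e : S} (he : IsIdempotentElem e)
    (huv : u * v⁻¹ ∈ N) (hd : JN N (u⁻¹ * u) (v⁻¹ * v)) :
    JN N (u⁻¹ * e * u) (v⁻¹ * e * v) := by
  obtain ⟨hrefl, hsymm, htrans, hmulc, hconj⟩ := hJ
  have hiu := idem_inv_mul u
  have hiv := idem_inv_mul v
  have hue := idem_conj u he
  have h₁ : JN N (v * (u⁻¹ * e * u) * v⁻¹) (e * ((u * v⁻¹) * (u * v⁻¹)⁻¹)) := by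
    have := JN_of_mem hinv (hmul (hfull he) huv)
    convert this using 1
    · simp only [mul_inv_rev', inv_inv', inv_of_idem he, mul_assoc, idem_mul_left he]
    · have hc := idem_comm he (idem_mul_inv (u * v⁻¹))
      rw [mul_inv_rev' e, inv_of_idem he, mul_assoc e, ← mul_assoc (u * v⁻¹), ← hc,
        idem_mul_left he]
  have h₂ : JN N ((u * v⁻¹) * (u * v⁻¹)⁻¹) (v * v⁻¹) := by
    have h₃ := hsymm _ _ (JN_of_mem hinv huv)
    have h₄ := hconj v⁻¹ _ _ hd
    rw [inv_inv'] at h₄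
    refine htrans _ _ _ h₃ ?_
    convert h₄ using 1
    · simp only [mul_inv_rev', inv_inv', mul_assoc]
    · rw [mul_inv_mul']
  have h₅ : JN N (v⁻¹ * (v * (u⁻¹ * e * u) * v⁻¹) * v) (v⁻¹ * e * v) := by
    have := hconj v _ _ (htrans _ _ _ h₁
      (hmulc _ _ _ _ he (idem_mul_inv _) he (idem_mul_inv _) (hrefl e he) h₂))
    convert this using 1
    simp only [mul_assoc, mul_inv_mul']
  refine htrans _ _ _ ?_ h₅
  have h₆ := hmulc _ _ _ _ hiu hue hiv hue hd (hrefl _ hue)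
  convert h₆ using 1
  · simp only [mul_assoc, inv_mul_cancel_left']
  · calc v⁻¹ * (v * (u⁻¹ * e * u) * v⁻¹) * v = v⁻¹ * v * ((u⁻¹ * e * u) * (v⁻¹ * v)) := by
          simp only [mul_assoc]
      _ = v⁻¹ * v * (u⁻¹ * e * u) := by
          rw [idem_comm hue hiv, idem_mul_left hiv]

theorem isCongruence_simeqN
    (hmul : ∀ {a b : S}, a ∈ N → b ∈ N → a * b ∈ N)
    (hinv : ∀ {a : S}, a ∈ N → a⁻¹ ∈ N)
    (hfull : ∀ {e : S}, IsIdempotentElem e → e ∈ N)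
    (hker : ∀ s t n : S, s * t ∈ N → n ∈ N → s * n * t ∈ N)
    (hJ : IsNormalCongruenceOnE (JN N)) : IsCongruence (SimeqN N) := by
  have iff := simeqN_iff hmul hinv hfull hker
  refine ⟨fun s => ?_, fun h => ⟨h.2, h.1⟩, fun {s t u} hst htu => ?_,
    fun {a b c d} hab hcd => ?_⟩
  · rw [iff]
    exact ⟨hfull (idem_mul_inv s), hJ.1 _ (idem_inv_mul s)⟩
  · rw [iff] at *
    refine ⟨?_, hJ.2.2.1 _ _ _ hst.2 htu.2⟩
    obtain ⟨hst, m, hm, -, -, hms, hmt, -⟩ := hst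
    rw [natLe_iff_of_idem (idem_mul_inv m) (idem_inv_mul t)] at hmt
    have h₁ : s * (t⁻¹ * t * u⁻¹) ∈ N := by
      simpa only [mul_assoc] using hmul hst htu.1
    have h₂ : s * (m⁻¹ * m * m⁻¹ * (t⁻¹ * t)) * u⁻¹ ∈ N := by
      rw [inv_mul_inv]
      simpa only [mul_assoc] using hker _ _ _ h₁ (hinv hm)
    rw [mul_assoc m⁻¹, mul_assoc m⁻¹, hmt, inv_mul_inv'] at h₂
    have h₃ := hker _ _ _ h₂ hm
    rwa [mul_assoc s, hms, mul_inv_mul'] at h₃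
  · rw [iff] at *
    constructor
    · have := hker _ _ _ hab.1 hcd.1
      simpa only [mul_inv_rev', mul_assoc] using this
    · have h₁ := hJ.2.2.2.2 c _ _ hab.2
      have h₂ := JN_conj_of_simeqN hmul hinv hfull hJ (idem_inv_mul b) hcd.1 hcd.2
      have h₃ := hJ.2.2.1 _ _ _ h₁ h₂
      simpa only [mul_inv_rev', mul_assoc] using h₃

end Kernel

end InverseSemigroup

namespace IsCongruence

open InverseSemigroup

variable {S : Type*} [InverseSemigroup S] {ρ : S → S → Prop}

theorem mul_left (h : IsCongruence ρ) (c : S) {a b : S} (hab : ρ a b) : ρ (c * a) (c * b) :=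
  h.mul_compat (h.refl c) hab

theorem mul_right (h : IsCongruence ρ) (c : S) {a b : S} (hab : ρ a b) : ρ (a * c) (b * c) :=
  h.mul_compat hab (h.refl c)

theorem inv_compat (h : IsCongruence ρ) {a b : S} (hab : ρ a b) : ρ a⁻¹ b⁻¹ := by
  have h₁ : ρ (a⁻¹ * (a * a⁻¹)) (a⁻¹ * (b * b⁻¹ * a * a⁻¹)) := by
    refine h.mul_left _ (h.mul_right _ (h.trans hab ?_))
    have := h.mul_left (b * b⁻¹) (h.symm hab)
    rwa [mul_inv_mul] at this
  have h₂ : ρ (b⁻¹ * b * b⁻¹) (b⁻¹ * (b * (a⁻¹ * a)) * b⁻¹) := by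
    refine h.mul_right _ (h.mul_left _ (h.trans (h.symm hab) ?_))
    have := h.mul_right (a⁻¹ * a) hab
    rwa [mul_inv_mul'] at this
  have e₁ : a⁻¹ * (b * b⁻¹ * a * a⁻¹) = a⁻¹ * b * b⁻¹ := by
    rw [mul_assoc (b * b⁻¹), idem_comm (idem_mul_inv b) (idem_mul_inv a)]
    simp only [mul_assoc, inv_mul_cancel_left']
  have e₂ : b⁻¹ * (b * (a⁻¹ * a)) * b⁻¹ = a⁻¹ * a * b⁻¹ := by
    rw [← mul_assoc b⁻¹, idem_comm (idem_inv_mul b) (idem_inv_mul a), mul_assoc, inv_mul_inv]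
  rw [e₁, inv_mul_inv'] at h₁
  rw [e₂, inv_mul_inv] at h₂
  exact h.trans h₁ (h.trans (h.mul_right _ (h.mul_left _ (h.symm hab))) (h.symm h₂))

theorem rel_of_rel_idem (h : IsCongruence ρ) {n g : S} (hg : IsIdempotentElem g) (hn : ρ n g) :
    ρ n (n⁻¹ * n) ∧ ρ n (n * n⁻¹) := by
  have hi := h.inv_compat hn
  rw [inv_of_idem hg] at hi
  have h₁ := h.mul_compat hi hn
  have h₂ := h.mul_compat hn hi
  rw [hg.eq] at h₁ h₂
  exact ⟨h.trans hn (h.symm h₁), h.trans hn (h.symm h₂)⟩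

theorem rel_of_JN (h : IsCongruence ρ) {N : Set S}
    (hN : ∀ n ∈ N, ∃ e : S, IsIdempotentElem e ∧ ρ n e) {e f : S} (hef : JN N e f) : ρ e f := by
  have key : ∀ m ∈ N, ∀ f : S, IsIdempotentElem f → NatLe (m * m⁻¹) f →
      ρ (m⁻¹ * m) (m⁻¹ * m * f) := by
    intro m hm f hf hmf
    rw [natLe_iff_of_idem (idem_mul_inv m) hf] at hmf
    obtain ⟨g, hg, hmg⟩ := hN m hm
    obtain ⟨h₁, h₂⟩ := h.rel_of_rel_idem hg hmg
    have h₃ := h.trans (h.symm h₁) h₂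
    have h₄ := h.mul_right f h₃
    rw [hmf] at h₄
    exact h.trans h₃ (h.symm h₄)
  obtain ⟨m, hm, n, hn, rfl, h₁, rfl, h₂⟩ := hef
  have h₃ := key m hm _ (idem_inv_mul n) h₁
  have h₄ := key n hn _ (idem_inv_mul m) h₂
  rw [idem_comm (idem_inv_mul n) (idem_inv_mul m)] at h₄
  exact h.trans h₃ (h.symm h₄)

theorem rel_of_mul_inv_rel_idem (h : IsCongruence ρ) {s t g : S} (hg : IsIdempotentElem g)
    (hst : ρ (s * t⁻¹) g) (hd : ρ (s⁻¹ * s) (t⁻¹ * t)) : ρ s t := by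
  obtain ⟨h₁, -⟩ := h.rel_of_rel_idem hg hst
  have h₂ : ρ ((s * t⁻¹)⁻¹ * (s * t⁻¹)) (t * t⁻¹) := by
    have := h.mul_right t⁻¹ (h.mul_left t hd)
    rw [mul_inv_mul'] at this
    simpa only [mul_inv_rev', inv_inv', mul_assoc] using this
  have h₃ := h.mul_left s hd
  have h₄ := h.mul_right t (h.trans h₁ h₂)
  rw [mul_inv_mul'] at h₃
  rw [mul_inv_mul, mul_assoc] at h₄
  exact h.trans h₃ h₄

end IsCongruence

/-- For a full inverse subsemigroup `N` with the kernel property, `≃_N` is a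
congruence on `S` iff `J_N` is a normal congruence on `E(S)`, and in that case
`≃_N` is the minimal congruence with kernel `N`. -/
theorem simeqN_congruence_iff_JN_normal {S : Type*} [InverseSemigroup S] {N : Set S}
    (hmul : ∀ {a b : S}, a ∈ N → b ∈ N → a * b ∈ N)
    (hinv : ∀ {a : S}, a ∈ N → a⁻¹ ∈ N)
    (hfull : ∀ {e : S}, IsIdempotentElem e → e ∈ N)
    (hker : ∀ s t n : S, s * t ∈ N → n ∈ N → s * n * t ∈ N) :
    (IsCongruence (SimeqN N) ↔ IsNormalCongruenceOnE (JN N)) ∧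
    (IsCongruence (SimeqN N) →
      ∀ ρ : S → S → Prop, IsCongruence ρ →
        {s : S | ∃ e : S, IsIdempotentElem e ∧ ρ s e} = N →
        ∀ s t : S, SimeqN N s t → ρ s t) := by
  refine ⟨⟨InverseSemigroup.isNormalCongruenceOnE_JN hmul hinv hfull hker,
    InverseSemigroup.isCongruence_simeqN hmul hinv hfull hker⟩, ?_⟩
  intro _ ρ hρ hN s t hst
  have hN' : ∀ n ∈ N, ∃ e : S, IsIdempotentElem e ∧ ρ n e := fun n hn => by
    rwa [← hN] at hn
  obtain ⟨hmem, hJ⟩ := (InverseSemigroup.simeqN_iff hmul hinv hfull hker s t).1 hst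
  obtain ⟨g, hg, hsg⟩ := hN' _ hmem
  exact hρ.rel_of_mul_inv_rel_idem hg hsg (hρ.rel_of_JN hN' hJ)
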